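/- arXiv:1207.6076 — 10 statements merged into one kernel-verified Lean document; each statement's English description precedes it below -/
import Mathlib

section
/- Let Z be a nonempty set and let ρ: Z×Z→[0,∞) be a semimetric on Z that has negative type. Then for every q with 0<q<1, the function ρ^q (defined by (z,z') ↦ ρ(z,z')^q) also has negative type, i.e., for all n≥2, points z_1,…,z_n ∈ Z and real numbers α_1,…,α_n with Σ_{i=1}^n α_i = 0, one has Σ_{i=1}^n Σ_{j=1}^n α_i α_j ρ(z_i,z_j)^q ≤ 0. -/
/-- A semimetric on a nonempty set `Z`: nonnegative, vanishing exactly on the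
diagonal, and symmetric. -/
def IsSemimetric {Z : Type*} (ρ : Z → Z → ℝ) : Prop :=
  (∀ z z', 0 ≤ ρ z z') ∧ (∀ z z', ρ z z' = 0 ↔ z = z') ∧ (∀ z z', ρ z z' = ρ z' z)

/-- A function `ρ` has negative type if for all `n ≥ 2`, points `z_1,…,z_n` and
reals `α_1,…,α_n` with `Σ α_i = 0`, one has `Σ_i Σ_j α_i α_j ρ(z_i,z_j) ≤ 0`. -/
def HasNegativeType {Z : Type*} (ρ : Z → Z → ℝ) : Prop :=
  ∀ (n : ℕ), 2 ≤ n → ∀ (z : Fin n → Z) (α : Fin n → ℝ),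
    (∑ i, α i) = 0 → ∑ i, ∑ j, α i * α j * ρ (z i) (z j) ≤ 0

open MeasureTheory

theorem Matrix.posSemidef_iff_sum_nonneg {ι : Type*} [Fintype ι] {A : Matrix ι ι ℝ} :
    A.PosSemidef ↔ (∀ i j, A i j = A j i) ∧ ∀ β : ι → ℝ, 0 ≤ ∑ i, ∑ j, β i * β j * A i j := by
  rw [Matrix.posSemidef_iff_dotProduct_mulVec, Matrix.IsHermitian.ext_iff]
  refine and_congr ⟨fun h i j ↦ h j i, fun h i j ↦ h j i⟩ (forall_congr' fun β ↦ ?_)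
  have : star β ⬝ᵥ (A.mulVec β) = ∑ i, ∑ j, β i * β j * A i j := by
    simp only [dotProduct, Matrix.mulVec, Finset.mul_sum, star_trivial]
    exact Finset.sum_congr rfl fun i _ ↦ Finset.sum_congr rfl fun j _ ↦ by ring
  rw [this]

/-- Entrywise powers of a positive semidefinite real matrix are positive semidefinite. -/
theorem Matrix.PosSemidef.map_pow {ι : Type*} [Fintype ι] {A : Matrix ι ι ℝ}
    (hA : A.PosSemidef) (k : ℕ) : (A.map (· ^ k)).PosSemidef := by
  induction k with
  | zero =>
    refine Matrix.posSemidef_iff_sum_nonneg.2 ⟨by simp, fun β ↦ ?_⟩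
    simp only [Matrix.map_apply, pow_zero, mul_one, ← Finset.mul_sum, ← Finset.sum_mul]
    exact mul_self_nonneg _
  | succ k ih =>
    have h : A.map (· ^ (k + 1)) = (A.map (· ^ k)).hadamard A := by
      ext i j
      simp [pow_succ]
    rw [h]
    exact ih.hadamard hA

/-- The entrywise exponential of a positive semidefinite real matrix is positive semidefinite. -/
theorem Matrix.PosSemidef.map_exp {ι : Type*} [Fintype ι] {A : Matrix ι ι ℝ}
    (hA : A.PosSemidef) : (A.map Real.exp).PosSemidef := by
  refine Matrix.posSemidef_iff_sum_nonneg.2 ⟨fun i j ↦ ?_, fun β ↦ ?_⟩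
  · simp [(Matrix.posSemidef_iff_sum_nonneg.1 hA).1 i j]
  have h : HasSum (fun k : ℕ ↦ ∑ i, ∑ j, β i * β j * (A i j ^ k / k.factorial))
      (∑ i, ∑ j, β i * β j * Real.exp (A i j)) := by
    refine hasSum_sum fun i _ ↦ hasSum_sum fun j _ ↦ HasSum.mul_left _ ?_
    rw [Real.exp_eq_exp_ℝ]
    exact NormedSpace.expSeries_div_hasSum_exp (A i j)
  refine h.nonneg fun k ↦ ?_
  have hk := (Matrix.posSemidef_iff_sum_nonneg.1 (hA.map_pow k)).2 β
  simp only [mul_div_assoc', ← Finset.sum_div]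
  exact div_nonneg hk (by positivity)

namespace HasNegativeType

variable {Z : Type*} {ρ : Z → Z → ℝ}

/-- The Gram matrix of a kernel of negative type based at a point `w` is positive semidefinite. -/
theorem posSemidef_gram (hneg : HasNegativeType ρ) (hsymm : ∀ z z', ρ z z' = ρ z' z)
    (w : Z) (hw : ρ w w = 0) {n : ℕ} (hn : n ≠ 0) (z : Fin n → Z) :
    (Matrix.of fun i j ↦ ρ (z i) w + ρ w (z j) - ρ (z i) (z j)).PosSemidef := by
  refine Matrix.posSemidef_iff_sum_nonneg.2 ⟨fun i j ↦ ?_, fun β ↦ ?_⟩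
  · simp only [Matrix.of_apply]
    rw [hsymm (z i) w, hsymm w (z j), hsymm (z i) (z j)]
    ring
  have h := hneg (n + 1) (by omega) (Fin.cons w z) (Fin.cons (-∑ i, β i) β)
    (by simp [Fin.sum_univ_succ])
  simp only [Fin.sum_univ_succ, Fin.cons_zero, Fin.cons_succ, hw, mul_zero, zero_add,
    Finset.sum_add_distrib] at h
  have h₁ : ∑ j, -(∑ i, β i) * β j * ρ w (z j) = -∑ i, ∑ j, β i * β j * ρ w (z j) := by
    rw [Finset.sum_comm]
    simp only [neg_mul, Finset.sum_neg_distrib, Finset.sum_mul]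
  have h₂ : ∑ i, β i * -(∑ j, β j) * ρ (z i) w = -∑ i, ∑ j, β i * β j * ρ (z i) w := by
    simp only [mul_neg, neg_mul, Finset.sum_neg_distrib, Finset.sum_mul, Finset.mul_sum]
  simp only [Matrix.of_apply, mul_sub, mul_add, Finset.sum_sub_distrib, Finset.sum_add_distrib]
  linarith

/-- Schoenberg: `exp (-s ρ)` is a positive semidefinite kernel if `ρ` has negative type. -/
theorem sum_mul_exp_nonneg (hneg : HasNegativeType ρ) (hsymm : ∀ z z', ρ z z' = ρ z' z)
    (hdiag : ∀ z, ρ z z = 0) {n : ℕ} (hn : n ≠ 0) (z : Fin n → Z) (α : Fin n → ℝ)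
    {s : ℝ} (hs : 0 ≤ s) : 0 ≤ ∑ i, ∑ j, α i * α j * Real.exp (-s * ρ (z i) (z j)) := by
  let w := z ⟨0, Nat.pos_of_ne_zero hn⟩
  have h := (Matrix.posSemidef_iff_sum_nonneg.1
    ((hneg.posSemidef_gram hsymm w (hdiag w) hn z).smul hs).map_exp).2
      fun i ↦ α i * Real.exp (-s * ρ (z i) w)
  refine h.trans_eq (Finset.sum_congr rfl fun i _ ↦ Finset.sum_congr rfl fun j _ ↦ ?_)
  simp only [Matrix.map_apply, Matrix.smul_apply, Matrix.of_apply, smul_eq_mul]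
  rw [show -s * ρ (z i) (z j) = -s * ρ (z i) w + -s * ρ (z j) w
    + s * (ρ (z i) w + ρ w (z j) - ρ (z i) (z j)) by rw [hsymm w (z j)]; ring,
    Real.exp_add, Real.exp_add]
  ring

theorem sum_mul_inv_add_nonneg (hneg : HasNegativeType ρ) (hsemi : IsSemimetric ρ)
    {n : ℕ} (hn : n ≠ 0) (z : Fin n → Z) (α : Fin n → ℝ) {t : ℝ} (ht : 0 < t) :
    0 ≤ ∑ i, ∑ j, α i * α j * (t + ρ (z i) (z j))⁻¹ := by
  have hpos (i j) : -(t + ρ (z i) (z j)) < 0 := by linarith [hsemi.1 (z i) (z j)]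
  have hint (i j) : IntegrableOn
      (fun s ↦ α i * α j * Real.exp (-(t + ρ (z i) (z j)) * s)) (Set.Ioi 0) :=
    (integrableOn_exp_mul_Ioi (hpos i j) 0).const_mul _
  have h : ∑ i, ∑ j, α i * α j * (t + ρ (z i) (z j))⁻¹ = ∫ s in Set.Ioi (0 : ℝ),
      ∑ i, ∑ j, α i * α j * Real.exp (-(t + ρ (z i) (z j)) * s) := by
    rw [integral_finsetSum _ fun i _ ↦ integrable_finsetSum _ fun j _ ↦ hint i j]
    refine Finset.sum_congr rfl fun i _ ↦ ?_
    rw [integral_finsetSum _ fun j _ ↦ hint i j]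
    refine Finset.sum_congr rfl fun j _ ↦ ?_
    rw [integral_const_mul, integral_exp_mul_Ioi (hpos i j)]
    simp [neg_div_neg_eq, -neg_add_rev]
  rw [h]
  refine setIntegral_nonneg measurableSet_Ioi fun s hs ↦ ?_
  have hexp := hneg.sum_mul_exp_nonneg hsemi.2.2 (fun z ↦ (hsemi.2.1 z z).2 rfl) hn z α
    (le_of_lt hs)
  refine (mul_nonneg (Real.exp_pos (-t * s)).le hexp).trans_eq ?_
  simp only [Finset.mul_sum]
  refine Finset.sum_congr rfl fun i _ ↦ Finset.sum_congr rfl fun j _ ↦ ?_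
  rw [show -(t + ρ (z i) (z j)) * s = -t * s + -s * ρ (z i) (z j) by ring, Real.exp_add]
  ring

end HasNegativeType

/-- if a semimetric `ρ` has negative type, then so does `ρ^q` for `0 < q < 1`. -/
theorem semimetric_rpow_hasNegativeType {Z : Type*} [Nonempty Z] (ρ : Z → Z → ℝ)
    (hsemi : IsSemimetric ρ) (hneg : HasNegativeType ρ)
    (q : ℝ) (hq0 : 0 < q) (hq1 : q < 1) :
    ∀ (n : ℕ), 2 ≤ n → ∀ (z : Fin n → Z) (α : Fin n → ℝ),
      (∑ i, α i) = 0 → ∑ i, ∑ j, α i * α j * (ρ (z i) (z j)) ^ q ≤ 0 := by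
  intro n hn z α hα
  obtain ⟨μ, hμ⟩ := Real.exists_measure_rpow_eq_integral_rpowIntegrand₀₁ ⟨hq0, hq1⟩
  have hint (i j) : IntegrableOn
      (fun t ↦ α i * α j * Real.rpowIntegrand₀₁ q t (ρ (z i) (z j))) (Set.Ioi 0) μ :=
    (hμ _ (hsemi.1 (z i) (z j))).1.const_mul _
  have h : ∑ i, ∑ j, α i * α j * ρ (z i) (z j) ^ q = ∫ t in Set.Ioi (0 : ℝ),
      ∑ i, ∑ j, α i * α j * Real.rpowIntegrand₀₁ q t (ρ (z i) (z j)) ∂μ := by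
    rw [integral_finsetSum _ fun i _ ↦ integrable_finsetSum _ fun j _ ↦ hint i j]
    refine Finset.sum_congr rfl fun i _ ↦ ?_
    rw [integral_finsetSum _ fun j _ ↦ hint i j]
    refine Finset.sum_congr rfl fun j _ ↦ ?_
    rw [integral_const_mul, (hμ _ (hsemi.1 (z i) (z j))).2]
  rw [h]
  refine setIntegral_nonpos measurableSet_Ioi fun t (ht : 0 < t) ↦ ?_
  have hinv := hneg.sum_mul_inv_add_nonneg hsemi (by omega : n ≠ 0) z α ht
  have hconst : ∑ i, ∑ j, α i * α j * t⁻¹ = 0 := by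
    simp [← Finset.sum_mul, ← Finset.mul_sum, hα]
  have heq : ∑ i, ∑ j, α i * α j * Real.rpowIntegrand₀₁ q t (ρ (z i) (z j))
      = t ^ q * (∑ i, ∑ j, α i * α j * t⁻¹ - ∑ i, ∑ j, α i * α j * (t + ρ (z i) (z j))⁻¹) := by
    simp only [← Finset.sum_sub_distrib, Finset.mul_sum, Real.rpowIntegrand₀₁]
    exact Finset.sum_congr rfl fun i _ ↦ Finset.sum_congr rfl fun j _ ↦ by ring
  rw [heq, hconst, zero_sub]
  exact mul_nonpos_of_nonneg_of_nonpos (Real.rpow_nonneg ht.le q) (neg_nonpos.2 hinv)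
end

section
/- Let ρ be a semimetric of negative type on a nonempty set Z. Then the function ρ^{1/2}: (z,z') ↦ ρ(z,z')^{1/2} is a metric on Z; in particular, even if ρ does not satisfy the triangle inequality, ρ^{1/2} satisfies ρ(z,z'')^{1/2} ≤ ρ(z,z')^{1/2} + ρ(z',z'')^{1/2} for all z,z',z''∈Z. -/
/-- The square root of a semimetric of negative type satisfies the triangle inequality. -/
theorem HasNegativeType.sqrt_triangle {Z : Type*} {ρ : Z → Z → ℝ}
    (hneg : HasNegativeType ρ) (hsemi : IsSemimetric ρ) (x y z : Z) :
    Real.sqrt (ρ x z) ≤ Real.sqrt (ρ x y) + Real.sqrt (ρ y z) := by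
  obtain ⟨hnonneg, hzero, hsymm⟩ := hsemi
  rcases eq_or_ne x y with rfl | hxy
  · exact le_add_of_nonneg_left (Real.sqrt_nonneg _)
  rcases eq_or_ne y z with rfl | hyz
  · exact le_add_of_nonneg_right (Real.sqrt_nonneg _)
  have ha : 0 < Real.sqrt (ρ x y) :=
    Real.sqrt_pos.2 ((hnonneg x y).lt_of_ne' (mt (hzero x y).1 hxy))
  have hb : 0 < Real.sqrt (ρ y z) :=
    Real.sqrt_pos.2 ((hnonneg y z).lt_of_ne' (mt (hzero y z).1 hyz))
  have ha2 := Real.sq_sqrt (hnonneg x y)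
  have hb2 := Real.sq_sqrt (hnonneg y z)
  set a := Real.sqrt (ρ x y)
  set b := Real.sqrt (ρ y z)
  have h := hneg 3 (by norm_num) ![x, y, z] ![b, -(a + b), a]
    (by simp [Fin.sum_univ_three])
  simp only [Fin.sum_univ_three, Matrix.cons_val] at h
  rw [(hzero x x).2 rfl, (hzero y y).2 rfl, (hzero z z).2 rfl, hsymm y x, hsymm z x,
    hsymm z y, ← ha2, ← hb2] at h
  refine Real.sqrt_le_iff.2 ⟨by positivity, ?_⟩
  refine le_of_mul_le_mul_left ?_ (mul_pos ha hb)
  linarith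

/-- if `ρ` is a semimetric of negative type on `Z`, then `ρ^{1/2}`
is a metric on `Z`; in particular it satisfies the triangle inequality. -/
theorem sqrt_of_negativeType_semimetric_is_metric {Z : Type*} [Nonempty Z]
    (ρ : Z → Z → ℝ) (hsemi : IsSemimetric ρ) (hneg : HasNegativeType ρ) :
    (∀ z z', 0 ≤ Real.sqrt (ρ z z')) ∧
    (∀ z z', Real.sqrt (ρ z z') = 0 ↔ z = z') ∧
    (∀ z z', Real.sqrt (ρ z z') = Real.sqrt (ρ z' z)) ∧
    (∀ z z' z'', Real.sqrt (ρ z z'') ≤ Real.sqrt (ρ z z') + Real.sqrt (ρ z' z'')) := by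
  exact ⟨fun _ _ => Real.sqrt_nonneg _,
    fun z z' => (Real.sqrt_eq_zero (hsemi.1 z z')).trans (hsemi.2.1 z z'),
    fun z z' => congrArg Real.sqrt (hsemi.2.2 z z'),
    hneg.sqrt_triangle hsemi⟩
end

section
/- Let Z be a nonempty set, ρ: Z×Z→[0,∞) a semimetric on Z, and fix z₀∈Z. Define k(z,z') = ρ(z,z₀) + ρ(z',z₀) − ρ(z,z'). Then k is a positive definite function on Z×Z (i.e., for all n, z_1,…,z_n ∈ Z and α_1,…,α_n ∈ ℝ, Σ_i Σ_j α_i α_j k(z_i,z_j) ≥ 0) if and only if ρ has negative type. -/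
/-- The quadratic form of `k` in terms of that of `ρ`. -/
theorem sum_sum_distance_kernel_eq {Z ι : Type*} [Fintype ι] (ρ : Z → Z → ℝ) (z₀ : Z)
    (z : ι → Z) (α : ι → ℝ) :
    ∑ i, ∑ j, α i * α j * (ρ (z i) z₀ + ρ (z j) z₀ - ρ (z i) (z j)) =
      2 * (∑ i, α i) * (∑ i, α i * ρ (z i) z₀) - ∑ i, ∑ j, α i * α j * ρ (z i) (z j) := by
  have h1 : ∑ i, ∑ j, α i * α j * ρ (z i) z₀ = (∑ i, α i * ρ (z i) z₀) * ∑ j, α j := by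
    rw [Finset.sum_mul_sum]
    exact Finset.sum_congr rfl fun i _ => Finset.sum_congr rfl fun j _ => by ring
  have h2 : ∑ i, ∑ j, α i * α j * ρ (z j) z₀ = (∑ i, α i) * ∑ j, α j * ρ (z j) z₀ := by
    rw [Finset.sum_mul_sum]
    exact Finset.sum_congr rfl fun i _ => Finset.sum_congr rfl fun j _ => by ring
  simp only [mul_sub, mul_add, Finset.sum_sub_distrib, Finset.sum_add_distrib, h1, h2]
  ring

/-- for a semimetric `ρ` on `Z` and `z₀ ∈ Z`, the function
`k(z,z') = ρ(z,z₀) + ρ(z',z₀) − ρ(z,z')` is positive definite iff `ρ` has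
negative type. -/
theorem distance_kernel_posdef_iff_negativeType {Z : Type*} [Nonempty Z]
    (ρ : Z → Z → ℝ) (hsemi : IsSemimetric ρ) (z₀ : Z)
    (k : Z → Z → ℝ) (hk : ∀ z z', k z z' = ρ z z₀ + ρ z' z₀ - ρ z z') :
    (∀ (n : ℕ) (z : Fin n → Z) (α : Fin n → ℝ),
        0 ≤ ∑ i, ∑ j, α i * α j * k (z i) (z j)) ↔ HasNegativeType ρ := by
  obtain ⟨-, hzero, hsymm⟩ := hsemi
  simp only [hk, sum_sum_distance_kernel_eq]
  constructor
  · intro h n _ z α hα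
    have := h n z α
    rw [hα] at this
    linarith
  · intro h n z α
    rcases Nat.eq_zero_or_pos n with rfl | hn
    · simp
    have key := h (n + 1) (by omega) (Fin.cons z₀ z) (Fin.cons (-∑ i, α i) α)
      (by simp [Fin.sum_univ_succ])
    have h1 : ∑ j, -(∑ i, α i) * α j * ρ z₀ (z j) =
        -(∑ i, α i) * ∑ j, α j * ρ (z j) z₀ := by
      rw [Finset.mul_sum]
      exact Finset.sum_congr rfl fun j _ => by rw [hsymm z₀]; ring
    have h2 : ∑ j, α j * -(∑ i, α i) * ρ (z j) z₀ =
        -(∑ i, α i) * ∑ j, α j * ρ (z j) z₀ := by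
      rw [Finset.mul_sum]
      exact Finset.sum_congr rfl fun j _ => by ring
    simp only [Fin.sum_univ_succ, Fin.cons_zero, Fin.cons_succ, (hzero z₀ z₀).2 rfl,
      Finset.sum_add_distrib, h1, h2] at key
    linarith
end

section
/- Let k be a nondegenerate kernel on a nonempty set Z, i.e., a symmetric positive definite function k: Z×Z→ℝ such that z ↦ k(·,z) is injective. Then ρ(z,z') = k(z,z) + k(z',z') − 2k(z,z') defines a semimetric of negative type on Z: ρ is nonnegative, symmetric, vanishes exactly on the diagonal, and for all n≥2, z_1,…,z_n ∈ Z and α_1,…,α_n ∈ ℝ with Σα_i = 0, Σ_iΣ_j α_iα_j ρ(z_i,z_j) ≤ 0. -/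
/-- A kernel on `Z`: a symmetric positive definite function `k : Z × Z → ℝ`. -/
def IsPosDefKernel {Z : Type*} (k : Z → Z → ℝ) : Prop :=
  (∀ z z', k z z' = k z' z) ∧
  ∀ (n : ℕ) (z : Fin n → Z) (α : Fin n → ℝ),
    0 ≤ ∑ i, ∑ j, α i * α j * k (z i) (z j)

/-- A positive definite kernel that assigns distance zero to `z` and `z'` has the same section
at both points. -/
theorem IsPosDefKernel.section_eq {Z : Type*} {k : Z → Z → ℝ} (hk : IsPosDefKernel k)
    {z z' : Z} (h : k z z + k z' z' - 2 * k z z' = 0) (w : Z) : k w z = k w z' := by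
  have hquad : ∀ t : ℝ, 0 ≤ k w w * (t * t) + (2 * (k w z - k w z')) * t + 0 := by
    intro t
    have ht := hk.2 3 ![z, z', w] ![1, -1, t]
    simp [Fin.sum_univ_three] at ht
    rw [hk.1 z' z, hk.1 z w, hk.1 z' w] at ht
    linarith
  have hdiscrim := discrim_le_zero hquad
  rw [discrim] at hdiscrim
  nlinarith

/-- The squared distance induced by a positive definite kernel is nonnegative. -/
theorem IsPosDefKernel.sqDist_nonneg {Z : Type*} {k : Z → Z → ℝ} (hk : IsPosDefKernel k)
    (z z' : Z) : 0 ≤ k z z + k z' z' - 2 * k z z' := by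
  have h := hk.2 2 ![z, z'] ![1, -1]
  simp [Fin.sum_univ_two] at h
  rw [hk.1 z' z] at h
  linarith

/-- On weights summing to zero, the quadratic form of the squared distance is `-2` times that
of `k`. -/
theorem sum_sum_mul_sqDist {ι Z : Type*} [Fintype ι] (k : Z → Z → ℝ) (z : ι → Z) (α : ι → ℝ)
    (hα : ∑ i, α i = 0) :
    ∑ i, ∑ j, α i * α j * (k (z i) (z i) + k (z j) (z j) - 2 * k (z i) (z j)) =
      -2 * ∑ i, ∑ j, α i * α j * k (z i) (z j) := by
  have hsplit : ∀ i j, α i * α j * (k (z i) (z i) + k (z j) (z j) - 2 * k (z i) (z j)) =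
      (α i * k (z i) (z i)) * α j + α i * (α j * k (z j) (z j)) +
        -2 * (α i * α j * k (z i) (z j)) := fun i j => by ring
  simp only [hsplit, Finset.sum_add_distrib, ← Finset.mul_sum, ← Finset.sum_mul, hα,
    mul_zero, zero_mul, zero_add]

/-- a nondegenerate kernel `k` generates a semimetric of negative
type via `ρ(z,z') = k(z,z) + k(z',z') − 2k(z,z')`. -/
theorem kernel_generates_negativeType_semimetric {Z : Type*} [Nonempty Z]
    (k : Z → Z → ℝ) (hk : IsPosDefKernel k)
    (hnondeg : ∀ z z', z ≠ z' → ∃ w, k w z ≠ k w z')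
    (ρ : Z → Z → ℝ) (hρ : ∀ z z', ρ z z' = k z z + k z' z' - 2 * k z z') :
    IsSemimetric ρ ∧ HasNegativeType ρ := by
  refine ⟨⟨fun z z' => ?_, fun z z' => ⟨fun h => ?_, ?_⟩, fun z z' => ?_⟩, ?_⟩
  · rw [hρ]
    exact hk.sqDist_nonneg z z'
  · by_contra hne
    obtain ⟨w, hw⟩ := hnondeg z z' hne
    exact hw (hk.section_eq (hρ z z' ▸ h) w)
  · rintro rfl
    rw [hρ]
    ring
  · rw [hρ, hρ, hk.1 z' z]
    ring
  · intro n _ z α hα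
    simp only [hρ]
    rw [sum_sum_mul_sqDist k z α hα]
    linarith [hk.2 n z α]
end

section
/- Let k and k̃ be two kernels on a nonempty set Z. Then k and k̃ generate the same semimetric, i.e., k(z,z)+k(z',z')−2k(z,z') = k̃(z,z)+k̃(z',z')−2k̃(z,z') for all z,z'∈Z, if and only if there exists a function f: Z→ℝ such that k̃(z,z') = k(z,z') + f(z) + f(z') for all z,z'∈Z. -/
/-- two kernels `k` and `k̃` generate the same semimetric iff they
differ by a shift `k̃(z,z') = k(z,z') + f(z) + f(z')`. -/
theorem equivalent_kernels_iff_shift {Z : Type*} [Nonempty Z]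
    (k ktil : Z → Z → ℝ) (hk : IsPosDefKernel k) (hktil : IsPosDefKernel ktil) :
    (∀ z z', k z z + k z' z' - 2 * k z z' = ktil z z + ktil z' z' - 2 * ktil z z') ↔
      ∃ f : Z → ℝ, ∀ z z', ktil z z' = k z z' + f z + f z' := by
  constructor
  · intro h
    refine ⟨fun z => (ktil z z - k z z) / 2, fun z z' => ?_⟩
    linarith [h z z']
  · rintro ⟨f, hf⟩ z z'
    rw [hf z z, hf z' z', hf z z']
    ring
end

section
/- Let k be a measurable kernel on a topological space Z and let P be a Borel probability measure on Z such that ∫ k(z,z) dP(z) < ∞. Define the kernel centred at P by k̃_P(z,z') = k(z,z') + ∫∫ k(w,w') dP(w) dP(w') − ∫ k(z,w) dP(w) − ∫ k(z',w) dP(w). Then k̃_P is a symmetric positive definite function on Z×Z, and k̃_P is equivalent to k, i.e., k̃_P(z,z)+k̃_P(z',z')−2k̃_P(z,z') = k(z,z)+k(z',z')−2k(z,z') for all z,z'∈Z. -/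
open MeasureTheory

namespace IsPosDefKernel

variable {Z : Type*} {k : Z → Z → ℝ}

theorem sum_nonneg {ι : Type*} [Fintype ι] (hk : IsPosDefKernel k) (z : ι → Z) (α : ι → ℝ) :
    0 ≤ ∑ i, ∑ j, α i * α j * k (z i) (z j) := by
  let e := Fintype.equivFin ι
  have h := hk.2 _ (z ∘ e.symm) (α ∘ e.symm)
  rw [← e.symm.sum_comp]
  simp_rw [← e.symm.sum_comp (fun j => α _ * α j * k (z _) (z j))]
  exact h

theorem sum_comp {W ι : Type*} [Fintype ι] (hk : IsPosDefKernel k) (c : ι → ℝ) (x : ι → W → Z) :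
    IsPosDefKernel fun w w' => ∑ p, ∑ q, c p * c q * k (x p w) (x q w') := by
  refine ⟨fun w w' => ?_, fun n w β => ?_⟩
  · beta_reduce
    rw [Finset.sum_comm]
    refine Finset.sum_congr rfl fun p _ => Finset.sum_congr rfl fun q _ => ?_
    rw [hk.1, mul_comm (c p)]
  · have h := hk.sum_nonneg (ι := Fin n × ι) (fun a => x a.2 (w a.1)) (fun a => β a.1 * c a.2)
    simp only [Fintype.sum_prod_type] at h
    refine h.trans_eq (Finset.sum_congr rfl fun a _ => ?_)
    rw [Finset.sum_comm]
    refine Finset.sum_congr rfl fun b _ => ?_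
    simp only [Finset.mul_sum]
    refine Finset.sum_congr rfl fun p _ => Finset.sum_congr rfl fun q _ => ?_
    ring

theorem diag_nonneg (hk : IsPosDefKernel k) (z : Z) : 0 ≤ k z z := by
  simpa using hk.sum_nonneg (fun _ : Unit => z) (fun _ => 1)

theorem abs_le (hk : IsPosDefKernel k) (z z' : Z) : |k z z'| ≤ k z z + k z' z' := by
  have h₁ := hk.2 2 ![z, z'] ![1, 1]
  have h₂ := hk.2 2 ![z, z'] ![1, -1]
  simp [Fin.sum_univ_two, hk.1 z' z] at h₁ h₂
  have := hk.diag_nonneg z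
  have := hk.diag_nonneg z'
  rw [_root_.abs_le]
  constructor <;> linarith

variable [MeasurableSpace Z] {P : Measure Z} [IsProbabilityMeasure P]

theorem integrable_prod (hk : IsPosDefKernel k) (hmeas : Measurable fun p : Z × Z => k p.1 p.2)
    (hint : Integrable (fun z => k z z) P) :
    Integrable (fun p : Z × Z => k p.1 p.2) (P.prod P) :=
  ((hint.comp_fst P).add (hint.comp_snd P)).mono' hmeas.aestronglyMeasurable
    (.of_forall fun p => hk.abs_le p.1 p.2)

theorem integrable_right (hk : IsPosDefKernel k) (hmeas : Measurable fun p : Z × Z => k p.1 p.2)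
    (hint : Integrable (fun z => k z z) P) (z : Z) : Integrable (k z) P :=
  ((integrable_const (k z z)).add hint).mono'
    (hmeas.comp measurable_prodMk_left).aestronglyMeasurable
    (.of_forall fun w => hk.abs_le z w)

theorem integral_prod_nonneg (hk : IsPosDefKernel k)
    (hprod : Integrable (fun p : Z × Z => k p.1 p.2) (P.prod P))
    (hint : Integrable (fun z => k z z) P) :
    0 ≤ ∫ p : Z × Z, k p.1 p.2 ∂P.prod P := by
  set C := ∫ p : Z × Z, k p.1 p.2 ∂P.prod P
  set D := ∫ z, k z z ∂P
  have hsample (n : ℕ) : 0 ≤ (n + 1) * D + (n + 1) * n * C := by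
    let μ : Measure (Fin (n + 1) → Z) := Measure.pi fun _ => P
    have hdiag (i : Fin (n + 1)) : MeasurePreserving (fun w : Fin (n + 1) → Z => w i) μ P :=
      measurePreserving_eval (fun _ => P) i
    have hpair {i j : Fin (n + 1)} (hij : i ≠ j) :
        MeasurePreserving (fun w : Fin (n + 1) → Z => (w i, w j)) μ (P.prod P) := by
      refine ⟨by fun_prop, ?_⟩
      have hind : ProbabilityTheory.iIndepFun (fun (i : Fin (n + 1)) w => w i) μ :=
        ProbabilityTheory.iIndepFun_pi (μ := fun _ => P) (X := fun _ z => z)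
          fun _ => aemeasurable_id
      have h := (ProbabilityTheory.indepFun_iff_map_prod_eq_prod_map_map
        (hdiag i).aemeasurable (hdiag j).aemeasurable).1 (hind.indepFun hij)
      rw [h, (hdiag i).map_eq, (hdiag j).map_eq]
    have hI (i j : Fin (n + 1)) : Integrable (fun w => k (w i) (w j)) μ := by
      rcases eq_or_ne i j with rfl | hij
      · exact (hdiag i).integrable_comp_of_integrable hint
      · exact (hpair hij).integrable_comp_of_integrable hprod
    have hval (i j : Fin (n + 1)) :
        ∫ w, k (w i) (w j) ∂μ = C + if i = j then D - C else 0 := by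
      split_ifs with hij
      · subst hij
        rw [add_sub_cancel, ← integral_map (φ := fun w : Fin (n + 1) → Z => w i)
          (f := fun z => k z z) (hdiag i).aemeasurable
          ((hdiag i).map_eq ▸ hint.aestronglyMeasurable), (hdiag i).map_eq]
      · rw [add_zero, ← integral_map (φ := fun w : Fin (n + 1) → Z => (w i, w j))
          (f := fun p : Z × Z => k p.1 p.2) (hpair hij).aemeasurable
          ((hpair hij).map_eq ▸ hprod.aestronglyMeasurable), (hpair hij).map_eq]
    have h : 0 ≤ ∫ w, ∑ i, ∑ j, k (w i) (w j) ∂μ :=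
      integral_nonneg fun w => by simpa using hk.2 (n + 1) w (fun _ => 1)
    rw [integral_finsetSum _ fun i _ => integrable_finsetSum _ fun j _ => hI i j] at h
    simp_rw [integral_finsetSum _ fun j _ => hI _ j, hval, Finset.sum_add_distrib] at h
    simp at h
    linarith
  by_contra! hC
  obtain ⟨n, hn⟩ := exists_nat_gt (D / -C)
  rw [div_lt_iff₀ (by linarith)] at hn
  have : (0 : ℝ) < n + 1 := by positivity
  nlinarith [hsample n]

end IsPosDefKernel

/-- for a measurable kernel `k` on a topological space `Z` and a
Borel probability measure `P` with `∫ k(z,z) dP(z) < ∞`, the kernel centred at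
`P`, `k̃_P(z,z') = k(z,z') + ∫∫ k dP dP − ∫ k(z,·) dP − ∫ k(z',·) dP`, is a
symmetric positive definite function equivalent to `k` (generating the same
semimetric). -/
theorem centred_kernel_is_kernel_and_equivalent {Z : Type*} [Nonempty Z]
    [TopologicalSpace Z] [MeasurableSpace Z] [BorelSpace Z]
    (k : Z → Z → ℝ) (hker : IsPosDefKernel k)
    (hmeas : Measurable fun p : Z × Z => k p.1 p.2)
    (P : Measure Z) [IsProbabilityMeasure P]
    (hint : Integrable (fun z => k z z) P)
    (ktilP : Z → Z → ℝ)
    (hktilP : ∀ z z', ktilP z z' =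
      k z z' + (∫ w, (∫ w', k w w' ∂P) ∂P) - (∫ w, k z w ∂P) - (∫ w, k z' w ∂P)) :
    IsPosDefKernel ktilP ∧
    (∀ z z', ktilP z z + ktilP z' z' - 2 * ktilP z z' =
      k z z + k z' z' - 2 * k z z') := by
  have hprod := hker.integrable_prod hmeas hint
  have hright := hker.integrable_right hmeas hint
  refine ⟨⟨fun z z' => ?_, fun n z α => ?_⟩, fun z z' => ?_⟩
  · rw [hktilP, hktilP, hker.1 z z']
    ring
  · set m : Z → ℝ := fun z => ∫ w, k z w ∂P
    set C : ℝ := ∫ w, ∫ w', k w w' ∂P ∂P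
    have hC : ∫ p : Z × Z, k p.1 p.2 ∂P.prod P = C := integral_prod _ hprod
    set A : ℝ := ∑ i, α i
    let c : Option (Fin n) → ℝ := fun p => p.elim (-A) α
    let x : Option (Fin n) → Z → Z := fun p w => p.elim w z
    have hleft (z : Z) : Integrable (fun w => k w z) P := by
      simpa only [hker.1 _ z] using hright z
    have hI (p q : Option (Fin n)) :
        Integrable (fun w : Z × Z => k (x p w.1) (x q w.2)) (P.prod P) := by
      rcases p with _ | i <;> rcases q with _ | j
      · exact hprod
      · exact (hleft (z j)).comp_fst P
      · exact (hright (z i)).comp_snd P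
      · exact integrable_const (μ := P.prod P) (k (z i) (z j))
    have hD (p q : Option (Fin n)) : Integrable (fun w => k (x p w) (x q w)) P := by
      rcases p with _ | i <;> rcases q with _ | j
      · exact hint
      · exact hleft (z j)
      · exact hright (z i)
      · exact integrable_const (μ := P) (k (z i) (z j))
    have h := (hker.sum_comp c x).integral_prod_nonneg (P := P)
      (integrable_finsetSum _ fun p _ => integrable_finsetSum _ fun q _ => (hI p q).const_mul _)
      (integrable_finsetSum _ fun p _ => integrable_finsetSum _ fun q _ => (hD p q).const_mul _)
    rw [integral_finsetSum _ fun p _ =>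
      integrable_finsetSum _ fun q _ => (hI p q).const_mul _] at h
    simp_rw [integral_finsetSum _ fun q _ => (hI _ q).const_mul _, integral_const_mul,
      Fintype.sum_option] at h
    have hfst (j : Fin n) : ∫ w : Z × Z, k w.1 (z j) ∂P.prod P = m (z j) := by
      rw [integral_fun_fst (fun w => k w (z j))]
      simp [m, hker.1 _ (z j)]
    have hsnd (i : Fin n) : ∫ w : Z × Z, k (z i) w.2 ∂P.prod P = m (z i) := by
      rw [integral_fun_snd (fun w => k (z i) w)]
      simp [m]
    simp only [c, x, Option.elim, hfst, hsnd, hC, integral_const, probReal_univ, one_smul,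
      Finset.sum_add_distrib] at h
    have hexpand : ∑ i, ∑ j, α i * α j * ktilP (z i) (z j) =
        (∑ i, ∑ j, α i * α j * k (z i) (z j)) + A * A * C - 2 * A * ∑ i, α i * m (z i) := by
      have h₁ : ∑ i, ∑ j, α i * α j * C = A * A * C := by
        rw [Finset.sum_mul_sum]
        simp only [Finset.sum_mul]
      have h₂ : ∑ i, ∑ j, α i * α j * m (z i) = A * ∑ i, α i * m (z i) := by
        rw [mul_comm, Finset.sum_mul_sum]
        exact Finset.sum_congr rfl fun i _ => Finset.sum_congr rfl fun j _ => by ring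
      have h₃ : ∑ i, ∑ j, α i * α j * m (z j) = A * ∑ i, α i * m (z i) := by
        rw [Finset.sum_mul_sum]
        exact Finset.sum_congr rfl fun i _ => Finset.sum_congr rfl fun j _ => by ring
      simp only [hktilP, mul_sub, mul_add, Finset.sum_add_distrib, Finset.sum_sub_distrib]
      change _ + ∑ i, ∑ j, α i * α j * C - ∑ i, ∑ j, α i * α j * m (z i)
        - ∑ i, ∑ j, α i * α j * m (z j) = _
      rw [h₁, h₂, h₃]
      ring
    have h₄ : ∑ j, -A * α j * m (z j) = -A * ∑ j, α j * m (z j) := by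
      rw [Finset.mul_sum]
      exact Finset.sum_congr rfl fun j _ => by ring
    have h₅ : ∑ j, α j * -A * m (z j) = -A * ∑ j, α j * m (z j) := by
      rw [Finset.mul_sum]
      exact Finset.sum_congr rfl fun j _ => by ring
    rw [h₄, h₅] at h
    rw [hexpand]
    linarith
  · simp only [hktilP]
    ring
end

section
/- Let k be a measurable kernel on a topological space Z that generates the semimetric ρ, i.e., ρ(z,z') = k(z,z)+k(z',z')−2k(z,z'), and let n be a positive integer. Then M_k^{n/2}(Z) = M_ρ^{n/2}(Z); that is, a finite signed Borel measure ν on Z satisfies ∫ k(z,z)^{n/2} d|ν|(z) < ∞ if and only if there exists z₀∈Z such that ∫ ρ(z,z₀)^{n/2} d|ν|(z) < ∞. In particular, if two kernels k₁ and k₂ generate the same semimetric ρ, then M_{k₁}^{n/2}(Z) = M_{k₂}^{n/2}(Z). -/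
open MeasureTheory

theorem MeasureTheory.Integrable.rpow_of_le_two_mul_add {Z : Type*} [MeasurableSpace Z]
    {μ : Measure Z} [IsFiniteMeasure μ] {f g : Z → ℝ} {c p : ℝ} (hp : 0 ≤ p) (hc : 0 ≤ c)
    (hf : ∀ z, 0 ≤ f z) (hg : ∀ z, 0 ≤ g z) (hgm : Measurable g)
    (hgf : ∀ z, g z ≤ 2 * f z + c) (hint : Integrable (fun z => f z ^ p) μ) :
    Integrable (fun z => g z ^ p) μ := by
  refine ((hint.const_mul (4 ^ p)).add (integrable_const ((2 * c) ^ p))).mono'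
    (hgm.pow_const p).aestronglyMeasurable (Filter.Eventually.of_forall fun z => ?_)
  have hfz := hf z
  have hgz := hgf z
  rw [Real.norm_of_nonneg (Real.rpow_nonneg (hg z) p)]
  simp only [Pi.add_apply]
  rw [← Real.mul_rpow (by norm_num) hfz]
  rcases le_total (2 * f z) c with h | h
  · have h1 := Real.rpow_le_rpow (hg z) (by linarith : g z ≤ 2 * c) hp
    have h2 := Real.rpow_nonneg (by positivity : 0 ≤ 4 * f z) p
    linarith
  · have h1 := Real.rpow_le_rpow (hg z) (by linarith : g z ≤ 4 * f z) hp
    have h2 := Real.rpow_nonneg (by positivity : 0 ≤ 2 * c) p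
    linarith

theorem IsPosDefKernel.quadratic_nonneg {Z : Type*} {k : Z → Z → ℝ} (hk : IsPosDefKernel k)
    (z w : Z) (a b : ℝ) :
    0 ≤ a ^ 2 * k z z + 2 * (a * b) * k z w + b ^ 2 * k w w := by
  have h := hk.2 2 ![z, w] ![a, b]
  simp only [Fin.sum_univ_two, Matrix.cons_val_zero, Matrix.cons_val_one] at h
  rw [hk.1 w z] at h
  linarith

/-- if a measurable kernel `k` generates the semimetric `ρ`, then
for every positive integer `n`, `M_k^{n/2}(Z) = M_ρ^{n/2}(Z)`: a finite signed
Borel measure `ν` satisfies `∫ k(z,z)^{n/2} d|ν|(z) < ∞` iff there exists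
`z₀ ∈ Z` with `∫ ρ(z,z₀)^{n/2} d|ν|(z) < ∞`.  (In particular, two kernels
generating the same semimetric have the same spaces `M^{n/2}`.) -/
theorem measures_with_finite_kernel_moments_eq_semimetric_moments
    {Z : Type*} [Nonempty Z] [TopologicalSpace Z] [MeasurableSpace Z] [BorelSpace Z]
    (k : Z → Z → ℝ) (hker : IsPosDefKernel k)
    (hmeas : Measurable fun p : Z × Z => k p.1 p.2)
    (ρ : Z → Z → ℝ) (hgen : ∀ z z', ρ z z' = k z z + k z' z' - 2 * k z z')
    (n : ℕ) (hn : 0 < n) (ν : SignedMeasure Z) :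
    Integrable (fun z => (k z z) ^ ((n : ℝ) / 2)) ν.totalVariation ↔
      ∃ z₀ : Z, Integrable (fun z => (ρ z z₀) ^ ((n : ℝ) / 2)) ν.totalVariation := by
  have hp : (0 : ℝ) ≤ (n : ℝ) / 2 := by positivity
  have hk0 : ∀ z, 0 ≤ k z z := fun z => by
    have := hker.quadratic_nonneg z z 1 0
    linarith
  have hρ0 : ∀ z w, 0 ≤ ρ z w := fun z w => by
    have := hker.quadratic_nonneg z w 1 (-1)
    rw [hgen]
    linarith
  have hkm : Measurable fun z => k z z := hmeas.comp (measurable_id.prodMk measurable_id)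
  have hρm : ∀ w, Measurable fun z => ρ z w := fun w => by
    simp only [hgen]
    exact (hkm.add_const _).sub
      ((hmeas.comp (measurable_id.prodMk measurable_const)).const_mul 2)
  have hc : ∀ w, 0 ≤ 2 * k w w := fun w => mul_nonneg zero_le_two (hk0 w)
  constructor
  · intro h
    obtain ⟨w⟩ := ‹Nonempty Z›
    refine ⟨w, h.rpow_of_le_two_mul_add hp (hc w) hk0 (fun z => hρ0 z w) (hρm w) fun z => ?_⟩
    have := hker.quadratic_nonneg z w 1 1
    rw [hgen]
    linarith
  · rintro ⟨w, h⟩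
    refine h.rpow_of_le_two_mul_add hp (hc w) (fun z => hρ0 z w) hk0 hkm fun z => ?_
    have := hker.quadratic_nonneg z w 1 (-2)
    rw [hgen]
    linarith
end

section
/- Let (X,ρ_X) and (Y,ρ_Y) be semimetric spaces of negative type, and let (X,Y) have joint distribution P_XY with marginals P_X, P_Y having finite second moments w.r.t. ρ_X and ρ_Y. Let k_X, k_Y be kernels generating ρ_X, ρ_Y, let k = k_X k_Y be the product kernel on X×Y, and let ρ̃ be the semimetric on X×Y such that (1/2)ρ̃ is the semimetric generated by k. Then the generalized distance covariance equals the energy distance between the joint distribution and the product of the marginals: V²_{ρ_X,ρ_Y}(X,Y) = D_{E,ρ̃}(P_XY, P_X P_Y). -/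
open MeasureTheory

namespace IsPosDefKernel

variable {Z : Type*} {k : Z → Z → ℝ}

theorem quadratic_nonneg_s13 (hk : IsPosDefKernel k) (z z' : Z) (s t : ℝ) :
    0 ≤ s ^ 2 * k z z + 2 * s * t * k z z' + t ^ 2 * k z' z' := by
  have h := hk.2 2 ![z, z'] ![s, t]
  simp only [Fin.sum_univ_two, Matrix.cons_val_zero, Matrix.cons_val_one] at h
  rw [hk.1 z' z] at h
  linarith

theorem sq_le_mul_diag (hk : IsPosDefKernel k) (z z' : Z) :
    k z z' ^ 2 ≤ k z z * k z' z' := by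
  rcases (hk.diag_nonneg z').eq_or_lt with h0 | hpos
  · have h := hk.quadratic_nonneg_s13 z z' (k z z') (-(k z z + 1) / 2)
    rw [← h0] at h ⊢
    linarith
  · have h := hk.quadratic_nonneg_s13 z z' (k z' z') (-k z z')
    have h' : 0 ≤ k z' z' * (k z z * k z' z' - k z z' ^ 2) := by linarith
    linarith [nonneg_of_mul_nonneg_right h' hpos]

theorem two_mul_abs_le (hk : IsPosDefKernel k) (z z' : Z) :
    2 * |k z z'| ≤ k z z + k z' z' := by
  have h₁ := hk.quadratic_nonneg_s13 z z' 1 1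
  have h₂ := hk.quadratic_nonneg_s13 z z' 1 (-1)
  rcases abs_cases (k z z') with ⟨h, _⟩ | ⟨h, _⟩ <;> rw [h] <;> linarith

theorem diag_le (hk : IsPosDefKernel k) (z z₀ : Z) :
    k z z ≤ 2 * (k z z + k z₀ z₀ - 2 * k z z₀) + 2 * k z₀ z₀ := by
  linarith [hk.quadratic_nonneg_s13 z z₀ 1 (-2)]

theorem two_mul_abs_mul_le {W : Type*} {l : W → W → ℝ} (hk : IsPosDefKernel k)
    (hl : IsPosDefKernel l) (z z' : Z) (w w' : W) :
    2 * |k z z' * l w w'| ≤ k z z * l w w + k z' z' * l w' w' := by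
  have hz : 0 ≤ k z z * l w w := mul_nonneg (hk.diag_nonneg z) (hl.diag_nonneg w)
  have hz' : 0 ≤ k z' z' * l w' w' := mul_nonneg (hk.diag_nonneg z') (hl.diag_nonneg w')
  have h : (k z z' * l w w') ^ 2 ≤ (k z z * l w w) * (k z' z' * l w' w') := by
    calc (k z z' * l w w') ^ 2 = k z z' ^ 2 * l w w' ^ 2 := by ring
      _ ≤ (k z z * k z' z') * (l w w * l w' w') :=
        mul_le_mul (hk.sq_le_mul_diag z z') (hl.sq_le_mul_diag w w') (sq_nonneg _)
          (mul_nonneg (hk.diag_nonneg z) (hk.diag_nonneg z'))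
      _ = _ := by ring
  have h2 : |2 * (k z z' * l w w')| ≤ |k z z * l w w + k z' z' * l w' w'| := by
    rw [← sq_le_sq]
    nlinarith [sq_nonneg (k z z * l w w - k z' z' * l w' w')]
  rwa [abs_mul, abs_two, abs_of_nonneg (add_nonneg hz hz')] at h2

variable [MeasurableSpace Z]

theorem memLp_diag (hk : IsPosDefKernel k) (hm : Measurable fun p : Z × Z => k p.1 p.2)
    {P : Measure Z} [IsProbabilityMeasure P] {z₀ : Z}
    (h : Integrable (fun z => (k z z + k z₀ z₀ - 2 * k z z₀) ^ 2) P) :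
    MemLp (fun z => k z z) 2 P := by
  have hd : Measurable fun z => k z z := hm.comp (measurable_id.prodMk measurable_id)
  have hz₀ : Measurable fun z => k z z₀ := hm.comp (measurable_id.prodMk measurable_const)
  have hρ : MemLp (fun z => k z z + k z₀ z₀ - 2 * k z z₀) 2 P :=
    (memLp_two_iff_integrable_sq
      ((hd.add_const _).sub (hz₀.const_mul 2)).aestronglyMeasurable).2 h
  refine ((hρ.const_mul 2).add (memLp_const (2 * k z₀ z₀))).mono hd.aestronglyMeasurable ?_
  refine Filter.Eventually.of_forall fun z => ?_
  rw [Real.norm_eq_abs, abs_of_nonneg (hk.diag_nonneg z)]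
  exact (hk.diag_le z z₀).trans (le_abs_self _)

theorem memLp_prod (hk : IsPosDefKernel k) (hm : Measurable fun p : Z × Z => k p.1 p.2)
    {P : Measure Z} [IsProbabilityMeasure P] (h : MemLp (fun z => k z z) 2 P) :
    MemLp (fun p : Z × Z => k p.1 p.2) 2 (P.prod P) := by
  have h₁ := h.comp_measurePreserving (measurePreserving_fst (μ := P) (ν := P))
  have h₂ := h.comp_measurePreserving (measurePreserving_snd (μ := P) (ν := P))
  refine (h₁.add h₂).mono hm.aestronglyMeasurable (Filter.Eventually.of_forall fun p => ?_)
  refine le_trans ?_ (le_abs_self _)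
  have := hk.two_mul_abs_le p.1 p.2
  simp only [Real.norm_eq_abs, Pi.add_apply, Function.comp_apply]
  linarith [abs_nonneg (k p.1 p.2)]

theorem memLp_integral (hk : IsPosDefKernel k) (hm : Measurable fun p : Z × Z => k p.1 p.2)
    {P : Measure Z} [IsProbabilityMeasure P] (h : MemLp (fun z => k z z) 2 P) :
    MemLp (fun z => ∫ z', k z z' ∂P) 2 P := by
  have hi : Integrable (fun z => k z z) P := h.integrable one_le_two
  refine (h.add (memLp_const (∫ z, k z z ∂P))).mono
    hm.stronglyMeasurable.integral_prod_right.aestronglyMeasurable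
    (Filter.Eventually.of_forall fun z => ?_)
  refine le_trans ?_ (le_abs_self _)
  have hb : ∫ z', (k z z + k z' z') ∂P = k z z + ∫ z', k z' z' ∂P := by
    rw [integral_add (integrable_const _) hi]; simp
  refine le_trans (norm_integral_le_of_norm_le ((integrable_const (k z z)).add hi)
    (Filter.Eventually.of_forall fun z' => ?_)) hb.le
  have := hk.two_mul_abs_le z z'
  simp only [Real.norm_eq_abs, Pi.add_apply]
  linarith [abs_nonneg (k z z')]

end IsPosDefKernel

theorem integral_add_sub_two_mul {Ω : Type*} [MeasurableSpace Ω] {μ : Measure Ω}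
    {f g h : Ω → ℝ} (hf : Integrable f μ) (hg : Integrable g μ) (hh : Integrable h μ) :
    ∫ ω, (f ω + g ω - 2 * h ω) ∂μ = ∫ ω, f ω ∂μ + ∫ ω, g ω ∂μ - 2 * ∫ ω, h ω ∂μ := by
  rw [← integral_const_mul, ← integral_add hf hg]
  exact integral_sub (hf.add hg) (hh.const_mul 2)

section DoubleIntegral

variable {Z : Type*} [MeasurableSpace Z] {k : Z → Z → ℝ}

theorem integrable_of_two_mul_abs_le (hm : Measurable fun p : Z × Z => k p.1 p.2)
    (hb : ∀ z z', 2 * |k z z'| ≤ k z z + k z' z') {P : Measure Z} [IsProbabilityMeasure P]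
    (hP : Integrable (fun z => k z z) P) (z : Z) : Integrable (fun z' => k z z') P := by
  refine ((integrable_const (k z z)).add hP).mono'
    (hm.comp (measurable_const.prodMk measurable_id)).aestronglyMeasurable
    (Filter.Eventually.of_forall fun z' => ?_)
  have := hb z z'
  simp only [Real.norm_eq_abs, Pi.add_apply]
  linarith [abs_nonneg (k z z')]

theorem integrable_prod_of_two_mul_abs_le (hm : Measurable fun p : Z × Z => k p.1 p.2)
    (hb : ∀ z z', 2 * |k z z'| ≤ k z z + k z' z') {P Q : Measure Z}
    [IsProbabilityMeasure P] [IsProbabilityMeasure Q]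
    (hP : Integrable (fun z => k z z) P) (hQ : Integrable (fun z => k z z) Q) :
    Integrable (fun p : Z × Z => k p.1 p.2) (P.prod Q) := by
  refine ((hP.comp_fst Q).add (hQ.comp_snd P)).mono' hm.aestronglyMeasurable
    (Filter.Eventually.of_forall fun p => ?_)
  have := hb p.1 p.2
  simp only [Real.norm_eq_abs, Pi.add_apply]
  linarith [abs_nonneg (k p.1 p.2)]

theorem integral_generated (hm : Measurable fun p : Z × Z => k p.1 p.2)
    (hb : ∀ z z', 2 * |k z z'| ≤ k z z + k z' z') {Q : Measure Z}
    [IsProbabilityMeasure Q] (hQ : Integrable (fun z => k z z) Q) (z : Z) :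
    ∫ z', (k z z + k z' z' - 2 * k z z') ∂Q =
      k z z + ∫ z', k z' z' ∂Q - 2 * ∫ z', k z z' ∂Q := by
  have hz := integrable_of_two_mul_abs_le hm hb hQ z
  rw [integral_add_sub_two_mul (integrable_const _) hQ hz]
  simp

theorem integral_integral_generated (hm : Measurable fun p : Z × Z => k p.1 p.2)
    (hb : ∀ z z', 2 * |k z z'| ≤ k z z + k z' z') {P Q : Measure Z}
    [IsProbabilityMeasure P] [IsProbabilityMeasure Q]
    (hP : Integrable (fun z => k z z) P) (hQ : Integrable (fun z => k z z) Q) :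
    ∫ z, ∫ z', (k z z + k z' z' - 2 * k z z') ∂Q ∂P =
      ∫ z, k z z ∂P + ∫ z, k z z ∂Q - 2 * ∫ z, ∫ z', k z z' ∂Q ∂P := by
  have hI := (integrable_prod_of_two_mul_abs_le hm hb hP hQ).integral_prod_left
  simp_rw [integral_generated hm hb hQ]
  rw [integral_add_sub_two_mul hP (integrable_const _) hI]
  simp

end DoubleIntegral

theorem integral_affine_mul {Ω : Type*} [MeasurableSpace Ω] {μ : Measure Ω}
    {a b c f g h : Ω → ℝ} (ha : MemLp a 2 μ) (hb : MemLp b 2 μ) (hc : MemLp c 2 μ)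
    (hf : MemLp f 2 μ) (hg : MemLp g 2 μ) (hh : MemLp h 2 μ) :
    ∫ ω, (a ω + b ω - 2 * c ω) * (f ω + g ω - 2 * h ω) ∂μ =
      ∫ ω, a ω * f ω ∂μ + ∫ ω, a ω * g ω ∂μ - 2 * ∫ ω, a ω * h ω ∂μ
        + ∫ ω, b ω * f ω ∂μ + ∫ ω, b ω * g ω ∂μ - 2 * ∫ ω, b ω * h ω ∂μ
        - 2 * ∫ ω, c ω * f ω ∂μ - 2 * ∫ ω, c ω * g ω ∂μ + 4 * ∫ ω, c ω * h ω ∂μ := by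
  have key : ∀ {u v : Ω → ℝ}, MemLp u 2 μ → MemLp v 2 μ → Integrable (fun ω => u ω * v ω) μ :=
    fun hu hv => hu.integrable_mul hv
  have split : ∀ {u : Ω → ℝ}, MemLp u 2 μ → ∫ ω, u ω * (f ω + g ω - 2 * h ω) ∂μ =
      ∫ ω, u ω * f ω ∂μ + ∫ ω, u ω * g ω ∂μ - 2 * ∫ ω, u ω * h ω ∂μ := fun {u} hu => by
    rw [← integral_add_sub_two_mul (key hu hf) (key hu hg) (key hu hh)]
    exact integral_congr_ae (Filter.Eventually.of_forall fun ω => by ring)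
  have hw : MemLp (fun ω => f ω + g ω - 2 * h ω) 2 μ := (hf.add hg).sub (hh.const_mul 2)
  calc _ = ∫ ω, a ω * (f ω + g ω - 2 * h ω) ∂μ + ∫ ω, b ω * (f ω + g ω - 2 * h ω) ∂μ
        - 2 * ∫ ω, c ω * (f ω + g ω - 2 * h ω) ∂μ := by
        rw [← integral_add_sub_two_mul (key ha hw) (key hb hw) (key hc hw)]
        exact integral_congr_ae (Filter.Eventually.of_forall fun ω => by ring)
    _ = _ := by
        rw [split ha, split hb, split hc]; ring

/-- in the setting of generalized distance covariance, if
`ρ̃` is the semimetric on `X × Y` such that `(1/2) ρ̃` is generated by the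
product kernel `k = k_X k_Y`, then the generalized distance covariance equals
the energy distance between the joint distribution and the product of the
marginals: `V²_{ρ_X,ρ_Y}(X,Y) = D_{E,ρ̃}(P_XY, P_X P_Y)`. -/
theorem distance_covariance_eq_energy_distance
    {X : Type*} {Y : Type*} [Nonempty X] [Nonempty Y]
    [TopologicalSpace X] [MeasurableSpace X] [BorelSpace X]
    [TopologicalSpace Y] [MeasurableSpace Y] [BorelSpace Y]
    (ρX : X → X → ℝ) (hsX : IsSemimetric ρX) (hnX : HasNegativeType ρX)
    (ρY : Y → Y → ℝ) (hsY : IsSemimetric ρY) (hnY : HasNegativeType ρY)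
    (kX : X → X → ℝ) (hkX : IsPosDefKernel kX)
    (hmX : Measurable fun p : X × X => kX p.1 p.2)
    (hgenX : ∀ x x', ρX x x' = kX x x + kX x' x' - 2 * kX x x')
    (kY : Y → Y → ℝ) (hkY : IsPosDefKernel kY)
    (hmY : Measurable fun p : Y × Y => kY p.1 p.2)
    (hgenY : ∀ y y', ρY y y' = kY y y + kY y' y' - 2 * kY y y')
    (k : X × Y → X × Y → ℝ)
    (hk : ∀ p p' : X × Y, k p p' = kX p.1 p'.1 * kY p.2 p'.2)
    (ρtil : X × Y → X × Y → ℝ)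
    (hρtil : ∀ p p' : X × Y, (1 / 2 : ℝ) * ρtil p p' = k p p + k p' p' - 2 * k p p')
    (PXY : Measure (X × Y)) [IsProbabilityMeasure PXY]
    (PX : Measure X) (hPX : PX = PXY.map Prod.fst)
    (PY : Measure Y) (hPY : PY = PXY.map Prod.snd)
    (hmomX : ∃ x₀ : X, Integrable (fun x => (ρX x x₀) ^ 2) PX)
    (hmomY : ∃ y₀ : Y, Integrable (fun y => (ρY y y₀) ^ 2) PY) :
    (∫ p, (∫ p', ρX p.1 p'.1 * ρY p.2 p'.2 ∂PXY) ∂PXY)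
      + (∫ x, (∫ x', ρX x x' ∂PX) ∂PX) * (∫ y, (∫ y', ρY y y' ∂PY) ∂PY)
      - 2 * (∫ p, (∫ x', ρX p.1 x' ∂PX) * (∫ y', ρY p.2 y' ∂PY) ∂PXY) =
    2 * (∫ p, (∫ p', ρtil p p' ∂(PX.prod PY)) ∂PXY)
      - (∫ p, (∫ p', ρtil p p' ∂PXY) ∂PXY)
      - (∫ p, (∫ p', ρtil p p' ∂(PX.prod PY)) ∂(PX.prod PY)) := by
  obtain ⟨x₀, hx₀⟩ := hmomX
  obtain ⟨y₀, hy₀⟩ := hmomY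
  have hpX : MeasurePreserving Prod.fst PXY PX := ⟨measurable_fst, hPX.symm⟩
  have hpY : MeasurePreserving Prod.snd PXY PY := ⟨measurable_snd, hPY.symm⟩
  have : IsProbabilityMeasure PX := hPX ▸ Measure.isProbabilityMeasure_map (by fun_prop)
  have : IsProbabilityMeasure PY := hPY ▸ Measure.isProbabilityMeasure_map (by fun_prop)
  simp_rw [hgenX] at hx₀
  simp_rw [hgenY] at hy₀
  have haX := hkX.memLp_diag hmX hx₀
  have haY := hkY.memLp_diag hmY hy₀
  have haX₁ := haX.integrable one_le_two
  have haY₁ := haY.integrable one_le_two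
  have hmk : Measurable fun q : (X × Y) × (X × Y) => k q.1 q.2 := by
    simp_rw [hk]
    exact (hmX.comp ((measurable_fst.comp measurable_fst).prodMk
      (measurable_fst.comp measurable_snd))).mul
      (hmY.comp ((measurable_snd.comp measurable_fst).prodMk
      (measurable_snd.comp measurable_snd)))
  have hbk : ∀ p p', 2 * |k p p'| ≤ k p p + k p' p' := fun p p' => by
    simp_rw [hk]
    exact hkX.two_mul_abs_mul_le hkY _ _ _ _
  have hu : MemLp (fun p : X × Y => kX p.1 p.1) 2 PXY := haX.comp_measurePreserving hpX
  have hv : MemLp (fun p : X × Y => kY p.2 p.2) 2 PXY := haY.comp_measurePreserving hpY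
  have hU : MemLp (fun p : X × Y => ∫ x', kX p.1 x' ∂PX) 2 PXY :=
    (hkX.memLp_integral hmX haX).comp_measurePreserving hpX
  have hV : MemLp (fun p : X × Y => ∫ y', kY p.2 y' ∂PY) 2 PXY :=
    (hkY.memLp_integral hmY haY).comp_measurePreserving hpY
  have mapX : ∀ f : X → ℝ, Measurable f → ∫ p, f p.1 ∂PXY = ∫ x, f x ∂PX := fun f hf => by
    rw [hPX, integral_map (by fun_prop) hf.aestronglyMeasurable]
  have mapY : ∀ f : Y → ℝ, Measurable f → ∫ p, f p.2 ∂PXY = ∫ y, f y ∂PY := fun f hf => by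
    rw [hPY, integral_map (by fun_prop) hf.aestronglyMeasurable]
  have hdX : Measurable fun x => kX x x := hmX.comp (measurable_id.prodMk measurable_id)
  have hdY : Measurable fun y => kY y y := hmY.comp (measurable_id.prodMk measurable_id)
  have hsX' : ∀ x, Measurable (kX x) := fun x => hmX.comp (measurable_const.prodMk measurable_id)
  have hsY' : ∀ y, Measurable (kY y) := fun y => hmY.comp (measurable_const.prodMk measurable_id)
  have hhX : Measurable fun x => ∫ x', kX x x' ∂PX :=
    hmX.stronglyMeasurable.integral_prod_right.measurable
  have hhY : Measurable fun y => ∫ y', kY y y' ∂PY :=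
    hmY.stronglyMeasurable.integral_prod_right.measurable
  have hdXY : Integrable (fun p => k p p) PXY := by
    simp_rw [hk]; exact hu.integrable_mul hv
  have hdprod : Integrable (fun p => k p p) (PX.prod PY) := by
    simp_rw [hk]; exact haX₁.mul_prod haY₁
  have hρ : ∀ p p', ρtil p p' = 2 * (k p p + k p' p' - 2 * k p p') := fun p p' => by
    linarith [hρtil p p']
  have htil : ∀ (P Q : Measure (X × Y)) [IsProbabilityMeasure P] [IsProbabilityMeasure Q],
      Integrable (fun p => k p p) P → Integrable (fun p => k p p) Q →
      ∫ p, ∫ p', ρtil p p' ∂Q ∂P =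
        2 * (∫ p, k p p ∂P + ∫ p, k p p ∂Q - 2 * ∫ p, ∫ p', k p p' ∂Q ∂P) :=
    fun P Q _ _ hP hQ => by
      simp_rw [hρ, integral_const_mul]
      rw [integral_integral_generated hmk hbk hP hQ]
  rw [htil _ _ hdXY hdprod, htil _ _ hdXY hdXY, htil _ _ hdprod hdprod]
  simp_rw [hgenX, hgenY]
  rw [integral_integral_generated hmX hkX.two_mul_abs_le haX₁ haX₁,
    integral_integral_generated hmY hkY.two_mul_abs_le haY₁ haY₁]
  simp_rw [integral_generated hmX hkX.two_mul_abs_le haX₁,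
    integral_generated hmY hkY.two_mul_abs_le haY₁]
  have hcross : ∫ p, ∫ p', k p p' ∂(PX.prod PY) ∂PXY =
      ∫ p, (∫ x', kX p.1 x' ∂PX) * (∫ y', kY p.2 y' ∂PY) ∂PXY := by
    simp_rw [hk]
    exact integral_congr_ae (Filter.Eventually.of_forall fun p =>
      integral_prod_mul (kX p.1) (kY p.2))
  have hprod : ∫ p, ∫ p', k p p' ∂(PX.prod PY) ∂(PX.prod PY) =
      (∫ x, ∫ x', kX x x' ∂PX ∂PX) * ∫ y, ∫ y', kY y y' ∂PY ∂PY := by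
    rw [← integral_prod_mul]
    simp_rw [hk]
    exact integral_congr_ae (Filter.Eventually.of_forall fun p =>
      integral_prod_mul (kX p.1) (kY p.2))
  rw [hcross, hprod]
  rw [integral_affine_mul hu (memLp_const _) hU hv (memLp_const _) hV]
  have hfst := measurePreserving_fst (μ := PXY) (ν := PXY)
  have hsnd := measurePreserving_snd (μ := PXY) (ν := PXY)
  have hu₁ : MemLp (fun q : (X × Y) × (X × Y) => kX q.1.1 q.1.1) 2 (PXY.prod PXY) :=
    hu.comp_measurePreserving hfst
  have hu₂ : MemLp (fun q : (X × Y) × (X × Y) => kX q.2.1 q.2.1) 2 (PXY.prod PXY) :=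
    hu.comp_measurePreserving hsnd
  have hv₁ : MemLp (fun q : (X × Y) × (X × Y) => kY q.1.2 q.1.2) 2 (PXY.prod PXY) :=
    hv.comp_measurePreserving hfst
  have hv₂ : MemLp (fun q : (X × Y) × (X × Y) => kY q.2.2 q.2.2) 2 (PXY.prod PXY) :=
    hv.comp_measurePreserving hsnd
  have hkX₂ : MemLp (fun q : (X × Y) × (X × Y) => kX q.1.1 q.2.1) 2 (PXY.prod PXY) :=
    (hkX.memLp_prod hmX haX).comp_measurePreserving (hpX.prod hpX)
  have hkY₂ : MemLp (fun q : (X × Y) × (X × Y) => kY q.1.2 q.2.2) 2 (PXY.prod PXY) :=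
    (hkY.memLp_prod hmY haY).comp_measurePreserving (hpY.prod hpY)
  have hmul : ∀ {u v : (X × Y) × (X × Y) → ℝ}, MemLp u 2 (PXY.prod PXY) →
      MemLp v 2 (PXY.prod PXY) → Integrable (fun q => u q * v q) (PXY.prod PXY) :=
    fun hu hv => hu.integrable_mul hv
  have hT : ∫ p, ∫ p', (kX p.1 p.1 + kX p'.1 p'.1 - 2 * kX p.1 p'.1) *
        (kY p.2 p.2 + kY p'.2 p'.2 - 2 * kY p.2 p'.2) ∂PXY ∂PXY =
      ∫ q : (X × Y) × (X × Y), (kX q.1.1 q.1.1 + kX q.2.1 q.2.1 - 2 * kX q.1.1 q.2.1) *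
        (kY q.1.2 q.1.2 + kY q.2.2 q.2.2 - 2 * kY q.1.2 q.2.2) ∂(PXY.prod PXY) :=
    (integral_prod (μ := PXY) (ν := PXY) _ (((hu₁.add hu₂).sub (hkX₂.const_mul 2)).integrable_mul
      ((hv₁.add hv₂).sub (hkY₂.const_mul 2)))).symm
  rw [hT, integral_affine_mul hu₁ hu₂ hkX₂ hv₁ hv₂ hkY₂]
  have e₁ : ∫ q : (X × Y) × (X × Y), kX q.1.1 q.1.1 * kY q.1.2 q.1.2 ∂(PXY.prod PXY) =
      ∫ p, kX p.1 p.1 * kY p.2 p.2 ∂PXY := by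
    rw [integral_prod _ (hmul hu₁ hv₁)]
    simp
  have e₂ : ∫ q : (X × Y) × (X × Y), kX q.2.1 q.2.1 * kY q.2.2 q.2.2 ∂(PXY.prod PXY) =
      ∫ p, kX p.1 p.1 * kY p.2 p.2 ∂PXY := by
    rw [integral_prod _ (hmul hu₂ hv₂)]
    simp
  have e₃ : ∫ q : (X × Y) × (X × Y), kX q.1.1 q.1.1 * kY q.2.2 q.2.2 ∂(PXY.prod PXY) =
      (∫ x, kX x x ∂PX) * ∫ y, kY y y ∂PY := by
    rw [← mapX _ hdX, ← mapY _ hdY]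
    exact integral_prod_mul (fun p : X × Y => kX p.1 p.1) (fun p : X × Y => kY p.2 p.2)
  have e₄ : ∫ q : (X × Y) × (X × Y), kX q.2.1 q.2.1 * kY q.1.2 q.1.2 ∂(PXY.prod PXY) =
      (∫ x, kX x x ∂PX) * ∫ y, kY y y ∂PY := by
    rw [← e₃]
    exact integral_prod_swap
      (fun q : (X × Y) × (X × Y) => kX q.1.1 q.1.1 * kY q.2.2 q.2.2)
  have e₅ : ∫ q : (X × Y) × (X × Y), kX q.1.1 q.1.1 * kY q.1.2 q.2.2 ∂(PXY.prod PXY) =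
      ∫ p, kX p.1 p.1 * ∫ y', kY p.2 y' ∂PY ∂PXY := by
    rw [integral_prod _ (hmul hu₁ hkY₂)]
    simp_rw [integral_const_mul, fun y => mapY (kY y) (hsY' y)]
  have e₆ : ∫ q : (X × Y) × (X × Y), kX q.2.1 q.2.1 * kY q.1.2 q.2.2 ∂(PXY.prod PXY) =
      ∫ p, kX p.1 p.1 * ∫ y', kY p.2 y' ∂PY ∂PXY := by
    rw [← e₅, ← integral_prod_swap]
    simp only [Prod.fst_swap, Prod.snd_swap, hkY.1]
  have e₇ : ∫ q : (X × Y) × (X × Y), kX q.1.1 q.2.1 * kY q.1.2 q.1.2 ∂(PXY.prod PXY) =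
      ∫ p, (∫ x', kX p.1 x' ∂PX) * kY p.2 p.2 ∂PXY := by
    rw [integral_prod _ (hmul hkX₂ hv₁)]
    simp_rw [integral_mul_const, fun x => mapX (kX x) (hsX' x)]
  have e₈ : ∫ q : (X × Y) × (X × Y), kX q.1.1 q.2.1 * kY q.2.2 q.2.2 ∂(PXY.prod PXY) =
      ∫ p, (∫ x', kX p.1 x' ∂PX) * kY p.2 p.2 ∂PXY := by
    rw [← e₇, ← integral_prod_swap]
    simp only [Prod.fst_swap, Prod.snd_swap]
    exact integral_congr_ae (Filter.Eventually.of_forall fun q => by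
      simp only [hkX.1 q.1.1 q.2.1])
  have e₉ : ∫ q : (X × Y) × (X × Y), kX q.1.1 q.2.1 * kY q.1.2 q.2.2 ∂(PXY.prod PXY) =
      ∫ p, ∫ p', k p p' ∂PXY ∂PXY := by
    rw [integral_prod _ (hmul hkX₂ hkY₂)]
    simp_rw [hk]
  rw [e₁, e₂, e₃, e₄, e₅, e₆, e₇, e₈, e₉]
  simp_rw [integral_mul_const, integral_const_mul]
  rw [mapX _ hdX, mapY _ hdY, mapX _ hhX, mapY _ hhY]
  simp only [integral_const, probReal_univ, smul_eq_mul, one_mul]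
  ring
end

section
/- Let (X,ρ_X) be a semimetric space of negative type, x₀∈X, and let k_X be the distance-induced kernel on X centred at x₀, k_X(x,x') = (1/2)[ρ_X(x,x₀)+ρ_X(x',x₀)−ρ_X(x,x')]. Let k_Y be any bounded measurable kernel on a topological space Y, and let k((x,y),(x',y')) = k_X(x,x')k_Y(y,y') be the product kernel on X×Y. Then for any two Borel probability measures P_Y, Q_Y on Y, γ_k²(δ_{x₀}×P_Y, δ_{x₀}×Q_Y) = ∫∫ k d([δ_{x₀}×P_Y − δ_{x₀}×Q_Y]×[δ_{x₀}×P_Y − δ_{x₀}×Q_Y]) = 0. In particular, the product kernel k is not characteristic to the set of Borel probability measures on X×Y even if k_X and k_Y are characteristic. -/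
open MeasureTheory

/-- A function vanishing on the slice `{x₀} × Y` has zero integral against `δ_{x₀} × μ`, with no
measurability assumption on the function. -/
theorem integral_dirac_prod_eq_zero {X Y : Type*} [MeasurableSpace X] [MeasurableSpace Y]
    (x₀ : X) (μ : Measure Y) [SFinite μ] (f : X × Y → ℝ) (hf : ∀ y, f (x₀, y) = 0) :
    ∫ p, f p ∂((Measure.dirac x₀).prod μ) = 0 := by
  by_cases h : AEStronglyMeasurable f ((Measure.dirac x₀).prod μ)
  · rw [Measure.dirac_prod] at h ⊢
    rw [integral_map measurable_prodMk_left.aemeasurable h]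
    simp [hf]
  · exact integral_non_aestronglyMeasurable h

/-- let `k_X` be the distance kernel induced by a semimetric
`ρ_X` of negative type, centred at `x₀`, and `k_Y` any bounded measurable
kernel on `Y`.  Then the product kernel `k = k_X k_Y` cannot distinguish
between the measures `δ_{x₀} × P_Y` and `δ_{x₀} × Q_Y`: the squared MMD
`γ_k²(δ_{x₀} × P_Y, δ_{x₀} × Q_Y)` vanishes for all Borel probability
measures `P_Y, Q_Y`, so `k` is not characteristic on `X × Y`. -/
theorem product_kernel_not_characteristic
    {X : Type*} {Y : Type*} [Nonempty X] [Nonempty Y]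
    [TopologicalSpace X] [MeasurableSpace X] [BorelSpace X]
    [TopologicalSpace Y] [MeasurableSpace Y] [BorelSpace Y]
    (ρX : X → X → ℝ) (hsX : IsSemimetric ρX) (hnX : HasNegativeType ρX)
    (x₀ : X) (kX : X → X → ℝ)
    (hkX : ∀ x x', kX x x' = (1 / 2 : ℝ) * (ρX x x₀ + ρX x' x₀ - ρX x x'))
    (kY : Y → Y → ℝ) (hkY : IsPosDefKernel kY)
    (hmY : Measurable fun p : Y × Y => kY p.1 p.2)
    (hbdd : ∃ C : ℝ, ∀ y y', |kY y y'| ≤ C)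
    (k : X × Y → X × Y → ℝ)
    (hk : ∀ p p' : X × Y, k p p' = kX p.1 p'.1 * kY p.2 p'.2)
    (PY QY : Measure Y) [IsProbabilityMeasure PY] [IsProbabilityMeasure QY] :
    (∫ p, (∫ p', k p p' ∂((Measure.dirac x₀).prod PY)) ∂((Measure.dirac x₀).prod PY))
      - (∫ p, (∫ p', k p p' ∂((Measure.dirac x₀).prod QY)) ∂((Measure.dirac x₀).prod PY))
      - (∫ p, (∫ p', k p p' ∂((Measure.dirac x₀).prod PY)) ∂((Measure.dirac x₀).prod QY))
      + (∫ p, (∫ p', k p p' ∂((Measure.dirac x₀).prod QY)) ∂((Measure.dirac x₀).prod QY))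
      = 0 := by
  have hk_zero : ∀ y p', k (x₀, y) p' = 0 := by
    intro y p'
    have hself : ρX x₀ x₀ = 0 := (hsX.2.1 x₀ x₀).2 rfl
    rw [hk, hkX, hself, hsX.2.2 p'.1 x₀]
    ring
  have hint : ∀ μ ν : Measure Y, SFinite ν →
      ∫ p, (∫ p', k p p' ∂((Measure.dirac x₀).prod μ)) ∂((Measure.dirac x₀).prod ν) = 0 := by
    intro μ ν _
    exact integral_dirac_prod_eq_zero x₀ ν _ fun y => by simp [hk_zero]
  simp [hint PY PY inferInstance, hint QY PY inferInstance, hint PY QY inferInstance,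
    hint QY QY inferInstance]
end

section
/- Let (Z,ρ) be a semimetric space of negative type and let P, Q be Borel probability measures on Z with finite first moments with respect to ρ. Then the energy distance is nonnegative: D_{E,ρ}(P,Q) = 2∫∫ρ(z,w)dP(z)dQ(w) − ∫∫ρ(z,z')dP(z)dP(z') − ∫∫ρ(w,w')dQ(w)dQ(w') ≥ 0; equivalently, ∫ρ d([P−Q]×[P−Q]) ≤ 0. -/
open MeasureTheory

/-- The relaxed triangle inequality satisfied by a semimetric of negative type. -/
theorem HasNegativeType.le_two_mul_add {Z : Type*} {ρ : Z → Z → ℝ} (hneg : HasNegativeType ρ)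
    (hsemi : IsSemimetric ρ) (x y z : Z) : ρ x y ≤ 2 * ρ x z + 2 * ρ y z := by
  obtain ⟨-, h0, hs⟩ := hsemi
  have h := hneg 3 (by norm_num) ![x, y, z] ![1, 1, -2] (by
    rw [Fin.sum_univ_three]
    change (1 : ℝ) + 1 + -2 = 0
    norm_num)
  have hd : ∀ a, ρ a a = 0 := fun a => (h0 a a).2 rfl
  simp [Fin.sum_univ_three, hd] at h
  linarith [hs y x, hs z x, hs z y]

/-- Negative type applied to two samples of equal size with opposite weights. -/
theorem HasNegativeType.sum_sub_nonneg {Z : Type*} {ρ : Z → Z → ℝ} (hneg : HasNegativeType ρ)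
    {n : ℕ} (hn : 1 ≤ n) (x y : Fin n → Z) :
    0 ≤ ∑ i, ∑ j, (ρ (x i) (y j) + ρ (y i) (x j) - ρ (x i) (x j) - ρ (y i) (y j)) := by
  have h := hneg (n + n) (by omega) (Fin.append x y) (Fin.append (fun _ => 1) (fun _ => -1))
    (by simp only [Fin.sum_univ_add, Fin.append_left, Fin.append_right]; simp)
  simp only [Fin.sum_univ_add, Fin.append_left, Fin.append_right, Finset.sum_add_distrib] at h
  simp only [one_mul, mul_one, mul_neg, neg_mul, neg_neg, Finset.sum_neg_distrib] at h
  simp only [Finset.sum_add_distrib, Finset.sum_sub_distrib]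
  linarith

/-- A moment centred at one point gives moments centred at every point. -/
theorem HasNegativeType.integrable_left {Z : Type*} [MeasurableSpace Z] {ρ : Z → Z → ℝ}
    (hneg : HasNegativeType ρ) (hsemi : IsSemimetric ρ)
    (hmeas : Measurable fun p : Z × Z => ρ p.1 p.2) {P : Measure Z} [IsFiniteMeasure P]
    {z₀ : Z} (hP : Integrable (fun z => ρ z z₀) P) (z₁ : Z) :
    Integrable (fun z => ρ z z₁) P := by
  refine ((hP.const_mul 2).add (integrable_const (2 * ρ z₁ z₀))).mono'
    (hmeas.comp measurable_prodMk_right).aestronglyMeasurable (.of_forall fun z => ?_)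
  rw [Real.norm_of_nonneg (hsemi.1 _ _)]
  exact hneg.le_two_mul_add hsemi _ _ _

theorem HasNegativeType.integrable_prod {Z : Type*} [MeasurableSpace Z] {ρ : Z → Z → ℝ}
    (hneg : HasNegativeType ρ) (hsemi : IsSemimetric ρ)
    (hmeas : Measurable fun p : Z × Z => ρ p.1 p.2)
    {P Q : Measure Z} [IsFiniteMeasure P] [IsFiniteMeasure Q]
    (hP : ∃ z₀, Integrable (fun z => ρ z z₀) P) (hQ : ∃ z₀, Integrable (fun z => ρ z z₀) Q) :
    Integrable (fun p : Z × Z => ρ p.1 p.2) (P.prod Q) := by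
  obtain ⟨z₀, hP⟩ := hP
  obtain ⟨z₁, hQ⟩ := hQ
  have hQ' := hneg.integrable_left hsemi hmeas hQ z₀
  refine (((hP.comp_fst Q).const_mul 2).add ((hQ'.comp_snd P).const_mul 2)).mono'
    hmeas.aestronglyMeasurable (.of_forall fun p => ?_)
  rw [Real.norm_of_nonneg (hsemi.1 _ _)]
  exact hneg.le_two_mul_add hsemi _ _ _

/-- Distinct coordinates of a product of copies of `μ` are jointly distributed as `μ.prod μ`. -/
theorem measurePreserving_eval_prodMk {X : Type*} [MeasurableSpace X] (μ : Measure X)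
    [IsProbabilityMeasure μ] {ι : Type*} [Fintype ι] {i j : ι} (hij : i ≠ j) :
    MeasurePreserving (fun x : ι → X => (x i, x j)) (Measure.pi fun _ => μ) (μ.prod μ) := by
  refine ⟨by fun_prop, ?_⟩
  have h : ProbabilityTheory.iIndepFun (fun (k : ι) (x : ι → X) => x k)
      (Measure.pi fun _ : ι => μ) :=
    ProbabilityTheory.iIndepFun_pi (X := fun _ : ι => (id : X → X)) (fun _ => aemeasurable_id)
  have h' := (ProbabilityTheory.indepFun_iff_map_prod_eq_prod_map_map
    (measurable_pi_apply i).aemeasurable (measurable_pi_apply j).aemeasurable).1 (h.indepFun hij)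
  rw [h', (measurePreserving_eval (fun _ : ι => μ) i).map_eq,
    (measurePreserving_eval (fun _ : ι => μ) j).map_eq]

/-- A kernel with nonnegative empirical double sums has nonnegative double integral. -/
theorem integral_prod_self_nonneg_of_sum_nonneg {X : Type*} [MeasurableSpace X] {μ : Measure X}
    [IsProbabilityMeasure μ] {h : X × X → ℝ} (hint : Integrable h (μ.prod μ))
    (hdiag : Integrable (fun x => h (x, x)) μ)
    (hsum : ∀ n : ℕ, 1 ≤ n → ∀ x : Fin n → X, 0 ≤ ∑ i, ∑ j, h (x i, x j)) :
    0 ≤ ∫ p, h p ∂μ.prod μ := by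
  have key : ∀ n : ℕ, 0 ≤ (∫ x, h (x, x) ∂μ) + n * ∫ p, h p ∂μ.prod μ := by
    intro n
    let ν : Measure (Fin (n + 1) → X) := Measure.pi fun _ => μ
    have hval : ∀ i j : Fin (n + 1), Integrable (fun x => h (x i, x j)) ν ∧
        ∫ x, h (x i, x j) ∂ν
          = if i = j then ∫ x, h (x, x) ∂μ else ∫ p, h p ∂μ.prod μ := by
      intro i j
      split_ifs with hij
      · subst hij
        have hmp := measurePreserving_eval (fun _ : Fin (n + 1) => μ) i
        refine ⟨hmp.integrable_comp_of_integrable hdiag, ?_⟩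
        rw [← hmp.map_eq] at hdiag ⊢
        rw [integral_map hmp.measurable.aemeasurable hdiag.1]
      · have hmp := measurePreserving_eval_prodMk μ hij
        refine ⟨hmp.integrable_comp_of_integrable hint, ?_⟩
        have hint' := hint.1
        rw [← hmp.map_eq] at hint' ⊢
        rw [integral_map hmp.measurable.aemeasurable hint']
    have hnonneg : 0 ≤ ∫ x, ∑ i, ∑ j, h (x i, x j) ∂ν :=
      integral_nonneg fun x => hsum (n + 1) (by omega) x
    rw [integral_finsetSum _ fun i _ => integrable_finsetSum _ fun j _ => (hval i j).1] at hnonneg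
    have hrow : ∀ i : Fin (n + 1), ∫ x, ∑ j, h (x i, x j) ∂ν
        = (∫ x, h (x, x) ∂μ) + n * ∫ p, h p ∂μ.prod μ := by
      intro i
      rw [integral_finsetSum _ fun j _ => (hval i j).1, Fintype.sum_eq_add_sum_compl i,
        (hval i i).2, if_pos rfl, Finset.sum_congr rfl fun j hj => by
          rw [(hval i j).2, if_neg (by simpa [eq_comm] using hj)]]
      simp [Finset.card_compl]
    simp only [hrow, Finset.sum_const, Finset.card_univ, Fintype.card_fin, nsmul_eq_mul] at hnonneg
    exact nonneg_of_mul_nonneg_right hnonneg (by positivity)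
  by_contra! hlt
  obtain ⟨n, hn⟩ := exists_nat_gt ((∫ x, h (x, x) ∂μ) / -∫ p, h p ∂μ.prod μ)
  rw [div_lt_iff₀ (by linarith)] at hn
  linarith [key n]

/-- for a semimetric `ρ` of negative type and Borel probability
measures `P`, `Q` with finite first moments w.r.t. `ρ`, the energy distance is
nonnegative:
`D_{E,ρ}(P,Q) = 2 E ρ(Z,W) − E ρ(Z,Z') − E ρ(W,W') ≥ 0`. -/
theorem energy_distance_nonneg
    {Z : Type*} [Nonempty Z] [TopologicalSpace Z] [MeasurableSpace Z] [BorelSpace Z]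
    (ρ : Z → Z → ℝ) (hsemi : IsSemimetric ρ) (hneg : HasNegativeType ρ)
    (hmeas : Measurable fun p : Z × Z => ρ p.1 p.2)
    (P Q : Measure Z) [IsProbabilityMeasure P] [IsProbabilityMeasure Q]
    (hP : ∃ z₀ : Z, Integrable (fun z => ρ z z₀) P)
    (hQ : ∃ z₀ : Z, Integrable (fun w => ρ w z₀) Q) :
    0 ≤ 2 * (∫ z, (∫ w, ρ z w ∂Q) ∂P) - (∫ z, (∫ z', ρ z z' ∂P) ∂P)
        - (∫ w, (∫ w', ρ w w' ∂Q) ∂Q) := by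
  have hPQ := hneg.integrable_prod hsemi hmeas hP hQ
  have hQP := hneg.integrable_prod hsemi hmeas hQ hP
  have hPP := hneg.integrable_prod hsemi hmeas hP hP
  have hQQ := hneg.integrable_prod hsemi hmeas hQ hQ
  have hfst : MeasurePreserving Prod.fst (P.prod Q) P := measurePreserving_fst
  have hsnd : MeasurePreserving Prod.snd (P.prod Q) Q := measurePreserving_snd
  have transfer : ∀ {P' Q' : Measure Z} [IsProbabilityMeasure P'] [IsProbabilityMeasure Q']
      {f g : Z × Z → Z}, MeasurePreserving f (P.prod Q) P' → MeasurePreserving g (P.prod Q) Q' →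
      Integrable (fun p : Z × Z => ρ p.1 p.2) (P'.prod Q') →
      Integrable (fun p : (Z × Z) × (Z × Z) => ρ (f p.1) (g p.2)) ((P.prod Q).prod (P.prod Q)) ∧
      ∫ p, ρ (f p.1) (g p.2) ∂((P.prod Q).prod (P.prod Q)) = ∫ z, ∫ w, ρ z w ∂Q' ∂P' := by
    intro P' Q' _ _ f g hf hg hi
    have hfg := hf.prod hg
    refine ⟨hfg.integrable_comp_of_integrable hi, ?_⟩
    rw [integral_integral hi, ← hfg.map_eq,
      integral_map hfg.measurable.aemeasurable hmeas.aestronglyMeasurable]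
    rfl
  obtain ⟨i₁, e₁⟩ := transfer hfst hsnd hPQ
  obtain ⟨i₂, e₂⟩ := transfer hsnd hfst hQP
  obtain ⟨i₃, e₃⟩ := transfer hfst hfst hPP
  obtain ⟨i₄, e₄⟩ := transfer hsnd hsnd hQQ
  have hswap : ∫ z, ∫ w, ρ z w ∂P ∂Q = ∫ z, ∫ w, ρ z w ∂Q ∂P := by
    rw [integral_integral_swap hQP]
    simp only [hsemi.2.2]
  have hself : ∀ z, ρ z z = 0 := fun z => (hsemi.2.1 z z).2 rfl
  have hdiag : Integrable (fun p : Z × Z => ρ p.1 p.2 + ρ p.2 p.1 - ρ p.1 p.1 - ρ p.2 p.2)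
      (P.prod Q) := by
    refine (hPQ.add hPQ).congr (.of_forall fun p => ?_)
    simp [hself, hsemi.2.2 p.2 p.1]
  have hmain := integral_prod_self_nonneg_of_sum_nonneg (((i₁.add i₂).sub i₃).sub i₄) hdiag
    fun n hn x => hneg.sum_sub_nonneg hn (fun i => (x i).1) (fun i => (x i).2)
  have e := integral_sub ((i₁.add i₂).sub i₃) i₄
  have e' := integral_sub (i₁.add i₂) i₃
  have e'' := integral_add i₁ i₂
  simp only [Pi.add_apply, Pi.sub_apply] at hmain e e' e''
  rw [e, e', e'', e₁, e₂, e₃, e₄, hswap] at hmain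
  linarith
end
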